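/- Let 0 ≤ R < 1 and ε > 0, and let c_τ : [R,1] → (0,∞), τ ∈ (−ε,ε), be a family of C^{1,1} functions, each satisfying the Herglotz condition and the countable conjugacy condition, such that (τ,r) ↦ c_τ(r) is continuous, differentiable in τ, and (τ,r) ↦ ∂_τ c_τ(r) is continuous; if R = 0 assume additionally that c_τ'(0) = 0 for all τ. If lsp(c_τ) = lsp(c_0) for all τ ∈ (−ε,ε), then c_τ = c_0 for all τ ∈ (−ε,ε). -/

import Mathlib

/-- `c` is `C^{1,1}` on `[R,1]`: differentiable with Lipschitz derivative. -/
def IsC11On (c : ℝ → ℝ) (R : ℝ) : Prop :=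
  ∃ c' : ℝ → ℝ, ∃ K : NNReal,
    (∀ r ∈ Set.Icc R 1, HasDerivWithinAt c (c' r) (Set.Icc R 1) r) ∧
    LipschitzOnWith K c' (Set.Icc R 1)

/-- The Herglotz condition: `d/dr (r / c r) > 0` on `[R,1]`. -/
def HerglotzCond (c : ℝ → ℝ) (R : ℝ) : Prop :=
  ∀ r ∈ Set.Icc R 1, 0 < derivWithin (fun s => s / c s) (Set.Icc R 1) r

/-- Half length `L(r)` of the maximal geodesic of radius `r`. -/
noncomputable def Lfun (c : ℝ → ℝ) (r : ℝ) : ℝ :=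
  ∫ s in r..1, (c s)⁻¹ * (Real.sqrt (1 - (r * c s / (s * c r)) ^ 2))⁻¹

/-- Half of the angular distance `α(r)` between the endpoints of the maximal geodesic
of radius `r`. -/
noncomputable def alphaFun (c : ℝ → ℝ) (r : ℝ) : ℝ :=
  ∫ s in r..1, (r * c s) / (c r * s ^ 2) * (Real.sqrt (1 - (r * c s / (s * c r)) ^ 2))⁻¹

/-- The length spectrum (without inner reflections): lengths `2 n L(r)` of periodic
broken rays, where the broken ray of radius `r` closes up after `n` reflections and
`m` windings, `n, m` coprime positive integers with `n α(r) = m π`. -/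
noncomputable def lsp (c : ℝ → ℝ) (R : ℝ) : Set ℝ :=
  {ℓ | ∃ r ∈ Set.Ioo R 1, ∃ n m : ℕ, 0 < n ∧ 0 < m ∧ Nat.Coprime n m ∧
        (n : ℝ) * alphaFun c r = (m : ℝ) * Real.pi ∧ ℓ = 2 * (n : ℝ) * Lfun c r}

open Set MeasureTheory Filter Topology


theorem sqrt_diff_bound (a b : ℝ) (hb : b ≠ 0) : |√a - √b| ≤ |a - b| * (√|b|)⁻¹ := by
  have hb' : 0 < √|b| := Real.sqrt_pos.2 (abs_pos.2 hb)
  rw [← div_eq_mul_inv, le_div_iff₀ hb']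
  rcases lt_or_gt_of_ne hb with h | h
  · rw [Real.sqrt_eq_zero_of_nonpos h.le, sub_zero, abs_of_nonneg (Real.sqrt_nonneg _)]
    rcases le_or_gt a 0 with ha | ha
    · rw [Real.sqrt_eq_zero_of_nonpos ha]; simp
    · rw [abs_of_neg h] at *
      have h1 := Real.sq_sqrt ha.le
      have h2 := Real.sq_sqrt (show 0 ≤ -b by linarith)
      rw [abs_of_pos (by linarith)]
      nlinarith [sq_nonneg (√a - √(-b))]
  · rw [abs_of_pos h] at *
    have h2 := Real.sq_sqrt h.le
    rcases le_or_gt a 0 with ha | ha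
    · rw [Real.sqrt_eq_zero_of_nonpos ha, zero_sub, abs_neg, abs_of_pos hb', abs_of_neg (by linarith)]
      nlinarith
    · have h1 := Real.sq_sqrt ha.le
      have : a - b = (√a - √b) * (√a + √b) := by ring_nf; rw [h1, h2]
      rw [this, abs_mul]
      gcongr
      rw [abs_of_nonneg (by positivity)]
      linarith [Real.sqrt_nonneg a]

theorem inv_sqrt_abs_integrable (a b r0 : ℝ) :
    IntervalIntegrable (fun s => (√|s - r0|)⁻¹) volume a b := by
  have key : ∀ a b : ℝ, IntervalIntegrable (fun s => (√|s|)⁻¹) volume a b := by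
    have h0 : ∀ b : ℝ, 0 ≤ b → IntervalIntegrable (fun s => (√|s|)⁻¹) volume 0 b := by
      intro b hb
      have := intervalIntegral.intervalIntegrable_rpow' (a := 0) (b := b) (r := -(1/2)) (by norm_num)
      refine this.congr ?_
      intro s hs
      rw [uIoc_of_le hb] at hs
      simp only
      rw [abs_of_pos hs.1, Real.sqrt_eq_rpow, ← Real.rpow_neg hs.1.le]
    have h1 : ∀ b : ℝ, IntervalIntegrable (fun s => (√|s|)⁻¹) volume 0 b := by
      intro b
      rcases le_total 0 b with h | h
      · exact h0 b h
      · have := (h0 (-b) (by linarith)).comp_sub_left 0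
        simpa using this
    intro a b
    exact (h1 a).symm.trans (h1 b)
  have := (key (a - r0) (b - r0)).comp_sub_right r0
  simpa using this

theorem hasDerivAt_sqrt_integral (a r0 t0 C k δ : ℝ) (ha : 0 < a) (ha1 : a ≤ 1)
    (h : ℝ → ℝ → ℝ) (h' : ℝ → ℝ) (hk : 0 < k) (hδ : 0 < δ)
    (hcont : ∀ t ∈ Metric.ball t0 δ, ContinuousOn (h t) (Icc a 1))
    (hlip : ∀ t ∈ Metric.ball t0 δ, ∀ s ∈ Icc a 1, |h t s - h t0 s| ≤ C * |t - t0|)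
    (hd : ∀ s ∈ Icc a 1, HasDerivAt (fun t => h t s) (h' s) t0)
    (h'c : ContinuousOn h' (Icc a 1))
    (hlow : ∀ s ∈ Icc a 1, k * |s - r0| ≤ |h t0 s|) :
    IntervalIntegrable (fun s => h' s * (2 * √(h t0 s))⁻¹ * s⁻¹) volume a 1 ∧
    HasDerivAt (fun t => ∫ s in a..1, √(h t s) * s⁻¹)
      (∫ s in a..1, h' s * (2 * √(h t0 s))⁻¹ * s⁻¹) t0 := by
  have hinv : ContinuousOn (fun s : ℝ => s⁻¹) (Icc a 1) :=
    continuousOn_id.inv₀ fun s hs => (lt_of_lt_of_le ha hs.1).ne'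
  have hsub : Ioc a 1 ⊆ Icc a 1 := Ioc_subset_Icc_self
  have hc0 : ∀ t ∈ Metric.ball t0 δ, ContinuousOn (fun s => √(h t s) * s⁻¹) (Icc a 1) :=
    fun t ht => (hcont t ht).sqrt.mul hinv
  have ht0 : t0 ∈ Metric.ball t0 δ := Metric.mem_ball_self hδ
  have hne : ∀ᵐ s ∂(volume.restrict (Ioc a 1)), s ∈ Ioc a 1 ∧ s ≠ r0 := by
    have h1 : ∀ᵐ s ∂(volume.restrict (Ioc a 1)), s ∈ Ioc a 1 := ae_restrict_mem measurableSet_Ioc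
    have h2 : ∀ᵐ s ∂(volume.restrict (Ioc a 1)), s ≠ r0 := by
      apply ae_restrict_of_ae
      exact Measure.ae_ne volume r0
    filter_upwards [h1, h2] with s hs hs' using ⟨hs, hs'⟩
  have hpos : ∀ s ∈ Ioc a 1, s ≠ r0 → 0 < k * |s - r0| := fun s _ hs' =>
    mul_pos hk (abs_pos.2 (sub_ne_zero.2 hs'))
  have hC : 0 ≤ C := by
    have h1 : t0 + δ / 2 ∈ Metric.ball t0 δ := by
      rw [Metric.mem_ball, Real.dist_eq]; simp; rw [abs_of_pos (by linarith)]; linarith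
    have := (abs_nonneg _).trans (hlip _ h1 1 ⟨ha1, le_rfl⟩)
    simp at this
    exact nonneg_of_mul_nonneg_left this (by positivity)
  have key := hasFDerivAt_integral_of_dominated_loc_of_lip' (𝕜 := ℝ)
    (μ := volume.restrict (Ioc a 1)) (s := Metric.ball t0 δ) (x₀ := t0)
    (F := fun t s => √(h t s) * s⁻¹)
    (F' := fun s => ContinuousLinearMap.toSpanSingleton ℝ (h' s * (2 * √(h t0 s))⁻¹ * s⁻¹))
    (bound := fun s => (C * (√k)⁻¹ * a⁻¹) * (√|s - r0|)⁻¹) (Metric.ball_mem_nhds _ hδ)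
    (fun t ht => ((hc0 t ht).mono hsub).aestronglyMeasurable measurableSet_Ioc)
    ((hc0 t0 ht0).integrableOn_Icc.mono_set hsub)
    ?_ ?_ ?_ ?_
  · obtain ⟨k1, k2⟩ := key
    have e : ∀ s, (ContinuousLinearMap.toSpanSingleton ℝ (h' s * (2 * √(h t0 s))⁻¹ * s⁻¹)) 1
       = (h' s * (2 * √(h t0 s))⁻¹ * s⁻¹) := by intro s; simp
    have k1' := k1.apply_continuousLinearMap (1:ℝ)
    simp only [e] at k1'
    refine ⟨by rw [intervalIntegrable_iff_integrableOn_Ioc_of_le ha1]; exact k1', ?_⟩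
    have k3 := k2.hasDerivAt
    rw [ContinuousLinearMap.integral_apply k1] at k3
    simp only [e] at k3
    simpa only [intervalIntegral.integral_of_le ha1] using k3
  · have hm : AEStronglyMeasurable (fun s => h' s * (2 * √(h t0 s))⁻¹ * s⁻¹)
        (volume.restrict (Ioc a 1)) := by
      have m1 := (h'c.mono hsub).aestronglyMeasurable (μ := volume) measurableSet_Ioc
      have m2 := ((hcont t0 ht0).sqrt.mono hsub).aestronglyMeasurable (μ := volume) measurableSet_Ioc
      have m3 := (hinv.mono hsub).aestronglyMeasurable (μ := volume) measurableSet_Ioc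
      exact (m1.mul (m2.aemeasurable.const_mul 2).inv.aestronglyMeasurable).mul m3
    have hcl : Continuous (fun x : ℝ => ContinuousLinearMap.toSpanSingleton ℝ x) := by
      exact (ContinuousLinearMap.toSpanSingletonLE ℝ ℝ ℝ).toLinearMap.continuous_of_finiteDimensional
    exact hcl.comp_aestronglyMeasurable hm
  · filter_upwards [hne] with s hs t ht
    have hsI := hsub hs.1
    have hs0 : 0 < s := ha.trans hs.1.1
    have hp := hpos s hs.1 hs.2
    have hb : h t0 s ≠ 0 := by
      have := hp.trans_le (hlow s hsI)
      exact abs_pos.1 this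
    rw [← sub_mul, Real.norm_eq_abs, Real.norm_eq_abs, abs_mul, abs_of_pos (inv_pos.2 hs0)]
    have e1 := sqrt_diff_bound (h t s) (h t0 s) hb
    have e2 := hlip t ht s hsI
    have e3 : (√|h t0 s|)⁻¹ ≤ (√k)⁻¹ * (√|s - r0|)⁻¹ := by
      rw [← mul_inv, ← Real.sqrt_mul hk.le]
      exact inv_anti₀ (Real.sqrt_pos.2 hp) (Real.sqrt_le_sqrt (hlow s hsI))
    have e4 : s⁻¹ ≤ a⁻¹ := inv_anti₀ ha hs.1.1.le
    calc |√(h t s) - √(h t0 s)| * s⁻¹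
        ≤ ((C * |t - t0|) * ((√k)⁻¹ * (√|s - r0|)⁻¹)) * a⁻¹ := by
          apply mul_le_mul _ e4 (by positivity) (by positivity)
          exact e1.trans (mul_le_mul e2 e3 (by positivity) (by positivity))
      _ = _ := by ring
  · have := (inv_sqrt_abs_integrable a 1 r0).const_mul (C * (√k)⁻¹ * a⁻¹)
    exact (intervalIntegrable_iff_integrableOn_Ioc_of_le ha1).1 this
  · filter_upwards [hne] with s hs
    have hsI := hsub hs.1
    have hp := hpos s hs.1 hs.2
    have hb : h t0 s ≠ 0 := abs_pos.1 (hp.trans_le (hlow s hsI))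
    have := ((hd s hsI).sqrt hb).mul_const s⁻¹
    rw [div_eq_mul_inv] at this
    exact this.hasFDerivAt

theorem herglotz_props (c : ℝ → ℝ) (R : ℝ) (hR1 : R < 1)
    (hpos : ∀ r ∈ Icc R 1, 0 < c r) (hC : IsC11On c R) (hH : HerglotzCond c R) :
    ∃ ρ' : ℝ → ℝ, ContinuousOn ρ' (Icc R 1) ∧ (∀ r ∈ Icc R 1, 0 < ρ' r) ∧
      (∀ r ∈ Icc R 1, HasDerivWithinAt (fun s => s / c s) (ρ' r) (Icc R 1) r) := by
  obtain ⟨c', K, hd, hL⟩ := hC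
  have hcc : ContinuousOn c (Icc R 1) := fun r hr => (hd r hr).continuousWithinAt
  have hder : ∀ r ∈ Icc R 1, HasDerivWithinAt (fun s => s / c s)
      ((1 * c r - r * c' r) / (c r) ^ 2) (Icc R 1) r := fun r hr =>
    (hasDerivWithinAt_id r _).div (hd r hr) (hpos r hr).ne'
  refine ⟨fun r => (1 * c r - r * c' r) / (c r) ^ 2, ?_, ?_, hder⟩
  · exact ((continuousOn_const.mul hcc).sub (continuousOn_id.mul hL.continuousOn)).div (hcc.pow 2)
      fun r hr => (pow_pos (hpos r hr) 2).ne'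
  · intro r hr
    have := hH r hr
    rwa [(hder r hr).derivWithin (uniqueDiffOn_Icc hR1 r hr)] at this

theorem herglotz_lower (ρ ρ' : ℝ → ℝ) (R : ℝ) (hR1 : R < 1)
    (hc : ContinuousOn ρ' (Icc R 1)) (hp : ∀ r ∈ Icc R 1, 0 < ρ' r)
    (hd : ∀ r ∈ Icc R 1, HasDerivWithinAt ρ (ρ' r) (Icc R 1) r) :
    ∃ k, 0 < k ∧ ∀ x ∈ Icc R 1, ∀ y ∈ Icc R 1, x ≤ y → k * (y - x) ≤ ρ y - ρ x := by
  obtain ⟨x0, hx0, hmin⟩ := isCompact_Icc.exists_isMinOn (nonempty_Icc.2 hR1.le) hc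
  refine ⟨ρ' x0, hp x0 hx0, ?_⟩
  have hda : ∀ x ∈ Ioo R 1, HasDerivAt ρ (ρ' x) x := fun x hx =>
    (hd x (Ioo_subset_Icc_self hx)).hasDerivAt (Icc_mem_nhds hx.1 hx.2)
  intro x hx y hy hxy
  refine (convex_Icc R 1).mul_sub_le_image_sub_of_le_deriv (f := ρ)
    (fun x hx => (hd x hx).continuousWithinAt) ?_ ?_ x hx y hy hxy
  · rw [interior_Icc]
    exact fun x hx => (hda x hx).differentiableAt.differentiableWithinAt
  · rw [interior_Icc]
    intro x hx
    rw [(hda x hx).deriv]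
    exact hmin (Ioo_subset_Icc_self hx)

/-- The key integral, as a function of the ray parameter. -/
noncomputable def Tfun (c : ℝ → ℝ) (a p : ℝ) : ℝ :=
  ∫ s in a..1, √((s / c s) ^ 2 - p ^ 2) * s⁻¹

theorem sq_lower (c : ℝ → ℝ) (R a r k : ℝ) (hR0 : 0 ≤ R) (ha : R < a) (hk : 0 < k)
    (hpos : ∀ r ∈ Icc R 1, 0 < c r)
    (hlow : ∀ x ∈ Icc R 1, ∀ y ∈ Icc R 1, x ≤ y → k * (y - x) ≤ y / c y - x / c x)
    (hr : r ∈ Ioo a 1) :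
    ∀ s ∈ Icc a 1, (k * (r / c r)) * |s - r| ≤ |(s / c s) ^ 2 - (r / c r) ^ 2| := by
  intro s hs
  have hrI : r ∈ Icc R 1 := ⟨by linarith [hr.1], hr.2.le⟩
  have hsI : s ∈ Icc R 1 := ⟨by linarith [hs.1], hs.2⟩
  have hp : 0 < r / c r := div_pos (by linarith [hr.1]) (hpos r hrI)
  have hp' : 0 < s / c s := div_pos (by linarith [hs.1]) (hpos s hsI)
  have e : (s / c s) ^ 2 - (r / c r) ^ 2 = (s / c s - r / c r) * (s / c s + r / c r) := by ring
  have h1 : k * |s - r| ≤ |s / c s - r / c r| := by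
    rcases le_total s r with h | h
    · rw [abs_sub_comm s r, abs_sub_comm (s / c s), abs_of_nonneg (by linarith)]
      exact (hlow s hsI r hrI h).trans (le_abs_self _)
    · rw [abs_of_nonneg (by linarith)]
      exact (hlow r hrI s hsI h).trans (le_abs_self _)
  rw [e, abs_mul, abs_of_pos (a := s / c s + r / c r) (by positivity)]
  have : k * (r / c r) * |s - r| = (k * |s - r|) * (r / c r) := by ring
  rw [this]
  exact mul_le_mul h1 (by linarith) hp.le (abs_nonneg _)

theorem sq_neg (c : ℝ → ℝ) (R a r k : ℝ) (hR0 : 0 ≤ R) (ha : R < a) (hk : 0 < k)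
    (hpos : ∀ r ∈ Icc R 1, 0 < c r)
    (hlow : ∀ x ∈ Icc R 1, ∀ y ∈ Icc R 1, x ≤ y → k * (y - x) ≤ y / c y - x / c x)
    (hr : r ∈ Ioo a 1) :
    ∀ s ∈ Icc a r, √((s / c s) ^ 2 - (r / c r) ^ 2) = 0 := by
  intro s hs
  have hrI : r ∈ Icc R 1 := ⟨by linarith [hr.1], hr.2.le⟩
  have hsI : s ∈ Icc R 1 := ⟨by linarith [hs.1], by linarith [hs.2, hr.2]⟩
  have hp' : 0 < s / c s := div_pos (by linarith [hs.1]) (hpos s hsI)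
  have := hlow s hsI r hrI hs.2
  have h2 : 0 ≤ k * (r - s) := mul_nonneg hk.le (by linarith [hs.2])
  apply Real.sqrt_eq_zero_of_nonpos
  nlinarith

theorem integral_cut (a r : ℝ) (hr : r ∈ Ioo a 1) (g : ℝ → ℝ)
    (hg : ∀ s ∈ Icc a r, g s = 0) : ∫ s in a..1, g s = ∫ s in r..1, g s := by
  rw [intervalIntegral.integral_of_le (by linarith [hr.1, hr.2]),
    intervalIntegral.integral_of_le hr.2.le]
  apply setIntegral_eq_of_subset_of_forall_sdiff_eq_zero measurableSet_Ioc
  · exact Ioc_subset_Ioc_left hr.1.le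
  · intro s hs
    apply hg
    refine ⟨hs.1.1.le, ?_⟩
    by_contra h
    exact hs.2 ⟨not_le.1 h, hs.1.2⟩

theorem T_main (c : ℝ → ℝ) (R a r k : ℝ) (hR0 : 0 ≤ R) (ha : R < a) (hk : 0 < k)
    (hpos : ∀ r ∈ Icc R 1, 0 < c r) (hc : ContinuousOn c (Icc R 1))
    (hlow : ∀ x ∈ Icc R 1, ∀ y ∈ Icc R 1, x ≤ y → k * (y - x) ≤ y / c y - x / c x)
    (hr : r ∈ Ioo a 1) :
    HasDerivAt (Tfun c a) (- alphaFun c r) (r / c r) ∧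
      Lfun c r = Tfun c a (r / c r) + (r / c r) * alphaFun c r := by
  have hrI : r ∈ Icc R 1 := ⟨by linarith [hr.1], hr.2.le⟩
  have hcr := hpos r hrI
  set p := r / c r with hp
  have hpp : 0 < p := div_pos (by linarith [hr.1]) hcr
  have hsub : Icc a 1 ⊆ Icc R 1 := Icc_subset_Icc_left ha.le
  have hρc : ContinuousOn (fun s => s / c s) (Icc a 1) :=
    continuousOn_id.div (hc.mono hsub) fun s hs => (hpos s (hsub hs)).ne'
  have hneg := sq_neg c R a r k hR0 ha hk hpos hlow hr
  have h1r : Ioc r 1 ⊆ Icc a 1 := fun s hs => ⟨by linarith [hs.1, hr.1], hs.2⟩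
  obtain ⟨hint, hder⟩ := hasDerivAt_sqrt_integral a r p (2 * p + 1) (k * p) 1 (by linarith)
    (by linarith [hr.1, hr.2]) (fun t s => (s / c s) ^ 2 - t ^ 2) (fun _ => - (2 * p))
    (by positivity) one_pos (fun t _ => (hρc.pow 2).sub continuousOn_const)
    (by
      intro t ht s _
      rw [Metric.mem_ball, Real.dist_eq] at ht
      have e : (s / c s) ^ 2 - t ^ 2 - ((s / c s) ^ 2 - p ^ 2) = (-(t + p)) * (t - p) := by ring
      rw [e, abs_mul, abs_neg]
      gcongr
      rw [abs_lt] at ht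
      rw [abs_le]; constructor <;> linarith)
    (fun s _ => by simpa using (hasDerivAt_pow 2 p).const_sub ((s / c s) ^ 2))
    continuousOn_const
    (sq_lower c R a r k hR0 ha hk hpos hlow hr)
  have hbig : ∀ s ∈ Ioc r 1, 0 < (s / c s) ^ 2 - p ^ 2 := by
    intro s hs
    have h1 := hlow r hrI s (hsub (h1r hs)) hs.1.le
    have h2 : 0 < k * (s - r) := mul_pos hk (by linarith [hs.1])
    nlinarith
  have hsq : ∀ s ∈ Ioc r 1, √(1 - (r * c s / (s * c r)) ^ 2) =
      √((s / c s) ^ 2 - p ^ 2) * (s / c s)⁻¹ := by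
    intro s hs
    have hs0 : 0 < s := by linarith [hs.1, hr.1]
    have hcs := hpos s (hsub (h1r hs))
    have e : 1 - (r * c s / (s * c r)) ^ 2 = ((s / c s) ^ 2 - p ^ 2) * ((s / c s)⁻¹) ^ 2 := by
      rw [hp]; field_simp
    rw [e, Real.sqrt_mul (hbig s hs).le, Real.sqrt_sq (by positivity)]
  have hα : alphaFun c r = p * ∫ s in r..1, (√((s / c s) ^ 2 - p ^ 2))⁻¹ * s⁻¹ := by
    unfold alphaFun
    rw [← intervalIntegral.integral_const_mul]
    apply intervalIntegral.integral_congr_ae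
    refine Eventually.of_forall fun s hs => ?_
    rw [uIoc_of_le hr.2.le] at hs
    rw [hsq s hs, hp]
    have hs0 : 0 < s := by linarith [hs.1, hr.1]
    have hcs := hpos s (hsub (h1r hs))
    have := Real.sqrt_pos.2 (hbig s hs)
    field_simp
  have hcut : ∫ s in a..1, -(2 * p) * (2 * √((s / c s) ^ 2 - p ^ 2))⁻¹ * s⁻¹ = - alphaFun c r := by
    rw [integral_cut a r hr _ (fun s hs => by rw [hneg s hs]; simp), hα, neg_mul_eq_neg_mul p,
      ← intervalIntegral.integral_const_mul]
    congr 1; ext s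
    rw [mul_inv]; ring
  refine ⟨by rw [← hcut]; exact hder, ?_⟩
  have hint2 : IntervalIntegrable (fun s => (√((s / c s) ^ 2 - p ^ 2))⁻¹ * s⁻¹) volume r 1 := by
    have := (hint.const_mul (-p⁻¹)).mono_set (c := r) (d := 1) (by
      rw [uIcc_of_le hr.2.le, uIcc_of_le (by linarith [hr.1, hr.2])]
      exact Icc_subset_Icc_left hr.1.le)
    refine this.congr (fun s _ => ?_)
    simp only [mul_inv]
    field_simp
  have hint3 : IntervalIntegrable (fun s => √((s / c s) ^ 2 - p ^ 2) * s⁻¹) volume r 1 := by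
    apply ContinuousOn.intervalIntegrable
    rw [uIcc_of_le hr.2.le]
    apply ContinuousOn.mono (s := Icc a 1) _ (Icc_subset_Icc_left hr.1.le)
    exact ((hρc.pow 2).sub continuousOn_const).sqrt.mul
      (continuousOn_id.inv₀ fun s hs => by simp only [id]; linarith [hs.1])
  rw [hα, Tfun, integral_cut a r hr _ (fun s hs => by rw [hneg s hs]; simp),
    ← intervalIntegral.integral_const_mul, ← intervalIntegral.integral_const_mul,
    ← intervalIntegral.integral_add hint3 ((hint2.const_mul _).const_mul _), Lfun]
  apply intervalIntegral.integral_congr_ae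
  refine Eventually.of_forall fun s hs => ?_
  rw [uIoc_of_le hr.2.le] at hs
  rw [hsq s hs]
  have hs0 : 0 < s := by linarith [hs.1, hr.1]
  have hcs := hpos s (hsub (h1r hs))
  have h4 := Real.sqrt_pos.2 (hbig s hs)
  have h5 := Real.sq_sqrt (hbig s hs).le
  set q := √((s / c s) ^ 2 - p ^ 2)
  have h6 : q * s⁻¹ + p * (p * (q⁻¹ * s⁻¹)) = (q ^ 2 + p ^ 2) * q⁻¹ * s⁻¹ := by field_simp
  rw [h6, h5]
  field_simp
  ring

theorem alpha_nonneg (c : ℝ → ℝ) (R r : ℝ) (hR0 : 0 ≤ R)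
    (hpos : ∀ r ∈ Icc R 1, 0 < c r) (hr : r ∈ Ioo R 1) : 0 ≤ alphaFun c r := by
  apply intervalIntegral.integral_nonneg hr.2.le
  intro s hs
  have h1 := hpos r ⟨hr.1.le, hr.2.le⟩
  have h2 := hpos s ⟨by linarith [hr.1, hs.1], hs.2⟩
  have h3 : 0 < r := by linarith [hr.1]
  positivity

theorem lsp_countable (c : ℝ → ℝ) (R : ℝ)
    (hccc : {r | r ∈ Ioo R 1 ∧ deriv (alphaFun c) r = 0}.Countable) : (lsp c R).Countable := by
  have hlev : ∀ l : ℝ, {r | r ∈ Ioo R 1 ∧ alphaFun c r = l}.Countable := by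
    intro l
    set B := {r | alphaFun c r = l ∧ deriv (alphaFun c) r ≠ 0} with hB
    have hBc : B.Countable := by
      have : DiscreteTopology B := by
        rw [discreteTopology_subtype_iff]
        intro x hx
        have hdx := (differentiableAt_of_deriv_ne_zero hx.2).hasDerivAt
        have := hdx.eventually_ne (c := l) hx.2
        rw [← disjoint_iff, Filter.disjoint_principal_right]
        filter_upwards [this] with y hy hy'
        exact hy hy'.1
      rw [← Set.countable_coe_iff]
      exact countable_of_Lindelof_of_discrete
    refine (hBc.union hccc).mono ?_
    rintro r ⟨hr, hl⟩
    by_cases h : deriv (alphaFun c) r = 0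
    · exact Or.inr ⟨hr, h⟩
    · exact Or.inl ⟨hl, h⟩
  have : lsp c R ⊆ ⋃ n : ℕ, ⋃ m : ℕ, (fun r => 2 * (n : ℝ) * Lfun c r) ''
      {r | r ∈ Ioo R 1 ∧ alphaFun c r = (m : ℝ) * Real.pi / n} := by
    rintro ℓ ⟨r, hr, n, m, hn, hm, -, h, rfl⟩
    refine mem_iUnion.2 ⟨n, mem_iUnion.2 ⟨m, ⟨r, ⟨hr, ?_⟩, rfl⟩⟩⟩
    rw [eq_div_iff (by positivity), mul_comm]; exact h
  exact (countable_iUnion fun n => countable_iUnion fun m => (hlev _).image _).mono this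


theorem abel_cont (V : ℝ → ℝ) (hV : Continuous V) (Y : ℝ) :
    Continuous (fun P => ∫ t in (0:ℝ)..√(Y - P), V (P + t ^ 2)) := by
  apply intervalIntegral.continuous_parametric_intervalIntegral_of_continuous
    (f := fun P t => V (P + t ^ 2))
  · simp only [Function.uncurry_def]; fun_prop
  · fun_prop

theorem abel_ind (V : ℝ → ℝ) (Y P : ℝ) (g : ℝ → ℝ) :
    ∫ t in Ioi (0:ℝ), g t * (Iio Y).indicator V (P + t ^ 2) =
      ∫ t in (0:ℝ)..√(Y - P), g t * V (P + t ^ 2) := by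
  have h1 : ∀ t ∈ Ioi (0:ℝ), g t * (Iio Y).indicator V (P + t ^ 2) =
      (Iio (√(Y - P))).indicator (fun t => g t * V (P + t ^ 2)) t := by
    intro t ht
    have ht0 : (0:ℝ) < t := ht
    have : P + t ^ 2 < Y ↔ t < √(Y - P) := by
      rw [Real.lt_sqrt ht0.le]
      constructor <;> intro h <;> linarith
    by_cases h : t < √(Y - P)
    · rw [indicator_of_mem (show t ∈ Iio _ from h), indicator_of_mem (show _ ∈ Iio _ from this.2 h)]
    · rw [indicator_of_notMem (show t ∉ Iio _ from h),
        indicator_of_notMem (show _ ∉ Iio _ from fun h' => h (this.1 h')), mul_zero]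
  rw [setIntegral_congr_fun measurableSet_Ioi h1, setIntegral_indicator measurableSet_Iio,
    intervalIntegral.integral_of_le (Real.sqrt_nonneg _), Ioi_inter_Iio,
    integral_Ioc_eq_integral_Ioo]

theorem abel_inj (V : ℝ → ℝ) (hV : Continuous V) (A Y : ℝ)
    (hz : ∀ P ∈ Ioo A Y, ∫ t in (0:ℝ)..√(Y - P), V (P + t ^ 2) = 0) :
    ∀ x ∈ Ioo A Y, V x = 0 := by
  set W : ℝ → ℝ := (Iio Y).indicator V with hW
  have hWm : Measurable W := hV.measurable.indicator measurableSet_Iio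
  have hG : ∀ P, A < P → ∫ t : ℝ, W (P + t ^ 2) = 0 := by
    intro P hP
    have h0 : ∫ t : ℝ, W (P + t ^ 2) = 2 * ∫ t in Ioi (0:ℝ), W (P + t ^ 2) := by
      have := integral_comp_abs (f := fun t => W (P + t ^ 2))
      simpa only [sq_abs] using this
    rw [h0]
    rcases lt_or_ge P Y with h | h
    · have := abel_ind V Y P (fun _ => 1)
      simp only [one_mul] at this
      rw [this, hz P ⟨hP, h⟩, mul_zero]
    · have : ∀ t ∈ Ioi (0:ℝ), W (P + t ^ 2) = 0 := by
        intro t _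
        apply indicator_of_notMem
        simp only [mem_Iio, not_lt]
        nlinarith [sq_nonneg t]
      rw [setIntegral_congr_fun measurableSet_Ioi this]
      simp
  have hI : ∀ x ∈ Ioo A Y, ∫ y in x..Y, V y = 0 := by
    intro x hx
    set f : ℝ × ℝ → ℝ := fun p => W (x + (p.1 ^ 2 + p.2 ^ 2)) with hf
    have hfm : Measurable f := hWm.comp (by fun_prop)
    have hfi : Integrable f := by
      obtain ⟨B, hB⟩ := (isCompact_Icc (a := x) (b := Y)).exists_bound_of_continuousOn
        hV.continuousOn
      set N := √(Y - x) with hN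
      set K : Set (ℝ × ℝ) := Icc (-N) N ×ˢ Icc (-N) N with hK
      have hKc : IsCompact K := isCompact_Icc.prod isCompact_Icc
      have hsupp : Function.support f ⊆ K := by
        intro p hp
        have hlt : x + (p.1 ^ 2 + p.2 ^ 2) < Y := by
          by_contra hcon
          exact hp (indicator_of_notMem (show _ ∉ Iio Y from hcon) _)
        have h1 : |p.1| ≤ N := Real.abs_le_sqrt (by nlinarith [sq_nonneg p.2])
        have h2 : |p.2| ≤ N := Real.abs_le_sqrt (by nlinarith [sq_nonneg p.1])
        exact ⟨abs_le.1 h1, abs_le.1 h2⟩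
      rw [← integrableOn_iff_integrable_of_support_subset hsupp]
      apply Measure.integrableOn_of_bounded (M := max B 0) hKc.measure_lt_top.ne
        hfm.aestronglyMeasurable
      refine Eventually.of_forall fun p => ?_
      by_cases h : x + (p.1 ^ 2 + p.2 ^ 2) < Y
      · have : f p = V (x + (p.1 ^ 2 + p.2 ^ 2)) := indicator_of_mem (show _ ∈ Iio Y from h) _
        rw [this]
        exact (hB _ ⟨by nlinarith [sq_nonneg p.1, sq_nonneg p.2], h.le⟩).trans (le_max_left _ _)
      · have : f p = 0 := indicator_of_notMem (show _ ∉ Iio Y from h) _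
        rw [this]; simp
    have hz0 : ∫ p, f p = 0 := by
      rw [Measure.volume_eq_prod] at hfi ⊢
      rw [integral_prod _ hfi]
      have : ∀ u : ℝ, ∫ v : ℝ, f (u, v) = 0 := by
        intro u
        have := hG (x + u ^ 2) (by nlinarith [sq_nonneg u, hx.1])
        simpa only [hf, add_assoc] using this
      simp [this]
    rw [← integral_comp_polarCoord_symm f] at hz0
    have hpol : ∀ p ∈ polarCoord.target, p.1 • f (polarCoord.symm p) =
        (fun r => r * W (x + r ^ 2)) p.1 * (fun _ => (1:ℝ)) p.2 := by
      intro p _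
      have : (p.1 * Real.cos p.2) ^ 2 + (p.1 * Real.sin p.2) ^ 2 = p.1 ^ 2 := by
        have := Real.cos_sq_add_sin_sq p.2
        linear_combination p.1 ^ 2 * this
      simp only [hf, polarCoord_symm_apply, smul_eq_mul, mul_one, this]
    rw [setIntegral_congr_fun polarCoord.open_target.measurableSet hpol, polarCoord_target,
      Measure.volume_eq_prod, setIntegral_prod_mul (fun r => r * W (x + r ^ 2)) (fun _ => (1:ℝ)),
      abel_ind V Y x _] at hz0
    have h2 : ∫ t in (0:ℝ)..√(Y - x), t * V (x + t ^ 2) = 0 := by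
      rcases mul_eq_zero.1 hz0 with h | h
      · exact h
      · exfalso
        simp at h
        have := Real.pi_pos
        linarith
    have h3 := intervalIntegral.integral_comp_mul_deriv (a := 0) (b := √(Y - x))
      (f := fun t => x + t ^ 2) (f' := fun t => 2 * t) (g := V)
      (fun t _ => by simpa using (hasDerivAt_pow 2 t).const_add x) (by fun_prop) hV
    simp only [Function.comp] at h3
    rw [Real.sq_sqrt (by linarith [hx.2])] at h3
    have h4 : (∫ t in (0:ℝ)..√(Y - x), V (x + t ^ 2) * (2 * t)) =
        2 * ∫ t in (0:ℝ)..√(Y - x), t * V (x + t ^ 2) := by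
      rw [← intervalIntegral.integral_const_mul]
      congr 1; ext t; ring
    rw [h4, h2] at h3
    simp at h3
    exact h3.symm
  intro x hx
  have hd := intervalIntegral.integral_hasDerivAt_left (hV.intervalIntegrable x Y)
    (hV.stronglyMeasurableAtFilter _ _) hV.continuousAt
  have hd2 : HasDerivAt (fun u => ∫ y in u..Y, V y) 0 x := by
    apply (hasDerivAt_const x (0:ℝ)).congr_of_eventuallyEq
    filter_upwards [Ioo_mem_nhds hx.1 hx.2] with u hu
    exact hI u hu
  have := hd.unique hd2
  linarith

theorem abel_apply (b : ℝ) (hb : b < 1) (f f' u : ℝ → ℝ)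
    (hd : ∀ s ∈ Icc b 1, HasDerivWithinAt f (f' s) (Icc b 1) s)
    (hf'c : ContinuousOn f' (Icc b 1)) (hf'p : ∀ s ∈ Icc b 1, 0 < f' s)
    (hu : ContinuousOn u (Icc b 1))
    (hz : ∀ r1 r2, b < r1 → r1 < r2 → r2 < 1 → ∃ r ∈ Ioo r1 r2,
      ∫ s in r..1, u s * (√(f s - f r))⁻¹ = 0) :
    ∀ s ∈ Ioo b 1, u s = 0 := by
  have hfc : ContinuousOn f (Icc b 1) := fun s hs => (hd s hs).continuousWithinAt
  have hda : ∀ s ∈ Ioo b 1, HasDerivAt f (f' s) s := fun s hs =>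
    (hd s (Ioo_subset_Icc_self hs)).hasDerivAt (Icc_mem_nhds hs.1 hs.2)
  have hmono : StrictMonoOn f (Icc b 1) := by
    apply strictMonoOn_of_deriv_pos (convex_Icc b 1) hfc
    rw [interior_Icc]
    intro s hs
    rw [(hda s hs).deriv]
    exact hf'p s (Ioo_subset_Icc_self hs)
  obtain ⟨V, hV⟩ : ∃ V : C(ℝ, ℝ), ∀ s ∈ Icc b 1, V (f s) = u s / f' s := by
    have hce : IsClosedEmbedding ((Icc b 1).domRestrict f) :=
      (continuousOn_iff_continuous_domRestrict.1 hfc).isClosedEmbedding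
        (injOn_iff_injective.1 hmono.injOn)
    have hq : ContinuousOn (fun s => u s / f' s) (Icc b 1) :=
      hu.div hf'c fun s hs => (hf'p s hs).ne'
    obtain ⟨V, hV⟩ := ContinuousMap.exists_extension hce
      ⟨(Icc b 1).domRestrict (fun s => u s / f' s), continuousOn_iff_continuous_domRestrict.1 hq⟩
    refine ⟨V, fun s hs => ?_⟩
    exact DFunLike.congr_fun hV ⟨s, hs⟩
  set Y := f 1 with hY
  have hsubst : ∀ r ∈ Ioo b 1, ∫ s in r..1, u s * (√(f s - f r))⁻¹ =
      2 * ∫ t in (0:ℝ)..√(Y - f r), V (f r + t ^ 2) := by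
    intro r hr
    have hrI := Ioo_subset_Icc_self hr
    have hsub : Ioo r 1 ⊆ Icc b 1 := fun s hs => ⟨by linarith [hs.1, hr.1], hs.2.le⟩
    have hsub' : Ioo r 1 ⊆ Ioo b 1 := fun s hs => ⟨by linarith [hs.1, hr.1], hs.2⟩
    have hbig : ∀ s ∈ Ioo r 1, 0 < f s - f r := fun s hs =>
      sub_pos.2 (hmono hrI (hsub hs) hs.1)
    have himg : (fun s => √(f s - f r)) '' Ioo r 1 = Ioo 0 (√(Y - f r)) := by
      apply Subset.antisymm
      · rintro _ ⟨s, hs, rfl⟩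
        refine ⟨Real.sqrt_pos.2 (hbig s hs), Real.sqrt_lt_sqrt (hbig s hs).le ?_⟩
        have := hmono (hsub hs) (right_mem_Icc.2 hb.le) hs.2
        linarith
      · have := intermediate_value_Ioo (f := fun s => √(f s - f r)) hr.2.le
          (((hfc.mono (Icc_subset_Icc_left hr.1.le)).sub continuousOn_const).sqrt)
        simpa using this
    have hinj : InjOn (fun s => √(f s - f r)) (Ioo r 1) := by
      intro s hs s' hs' h
      have := (Real.sqrt_inj (hbig s hs).le (hbig s' hs').le).1 h
      exact hmono.injOn (hsub hs) (hsub hs') (by linarith)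
    have key := integral_image_eq_integral_abs_deriv_smul (s := Ioo r 1)
      (f := fun s => √(f s - f r)) (f' := fun s => f' s / (2 * √(f s - f r))) measurableSet_Ioo
      (fun s hs => (((hda s (hsub' hs)).sub_const (f r)).sqrt (hbig s hs).ne').hasDerivWithinAt)
      hinj (fun t => V (f r + t ^ 2))
    rw [himg] at key
    rw [intervalIntegral.integral_of_le hr.2.le, intervalIntegral.integral_of_le (Real.sqrt_nonneg _),
      integral_Ioc_eq_integral_Ioo, integral_Ioc_eq_integral_Ioo, key, ← integral_const_mul]
    apply setIntegral_congr_fun measurableSet_Ioo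
    intro s hs
    have h1 := hf'p s (hsub hs)
    have h2 := Real.sqrt_pos.2 (hbig s hs)
    simp only [smul_eq_mul]
    rw [Real.sq_sqrt (hbig s hs).le, add_sub_cancel, hV s (hsub hs), abs_of_pos (by positivity)]
    field_simp
  have hcont := abel_cont V V.continuous Y
  have hK : ∀ P ∈ Ioo (f b) Y, ∫ t in (0:ℝ)..√(Y - P), V (P + t ^ 2) = 0 := by
    intro P hP
    obtain ⟨s, hs, rfl⟩ := intermediate_value_Ioo hb.le hfc hP
    by_contra hne
    have hca : ContinuousAt (fun r => ∫ t in (0:ℝ)..√(Y - f r), V (f r + t ^ 2)) s :=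
      ContinuousAt.comp (f := f) (g := fun P => ∫ t in (0:ℝ)..√(Y - P), V (P + t ^ 2))
        hcont.continuousAt (hda s hs).continuousAt
    have hev := (hca.eventually_ne hne).and (Ioo_mem_nhds hs.1 hs.2)
    obtain ⟨l, w, hlw, hsubs⟩ := mem_nhds_iff_exists_Ioo_subset.1 hev
    obtain ⟨r, hr, hr0⟩ := hz ((l + s) / 2) ((s + w) / 2)
      (by have := (hsubs (show (l + s) / 2 ∈ Ioo l w from ⟨by linarith [hlw.1], by linarith [hlw.1, hlw.2]⟩)).2.1; exact this)
      (by linarith [hlw.1, hlw.2])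
      (by have := (hsubs (show (s + w) / 2 ∈ Ioo l w from ⟨by linarith [hlw.1, hlw.2], by linarith [hlw.2]⟩)).2.2; exact this)
    have hr' := hsubs (show r ∈ Ioo l w from ⟨by linarith [hr.1, hlw.1], by linarith [hr.2, hlw.2]⟩)
    rw [hsubst r hr'.2] at hr0
    exact hr'.1 (by linarith)
  intro s hs
  have hsI := Ioo_subset_Icc_self hs
  have := abel_inj V V.continuous (f b) Y hK (f s)
    ⟨hmono (left_mem_Icc.2 hb.le) hsI hs.1, hmono hsI (right_mem_Icc.2 hb.le) hs.2⟩
  rw [hV s hsI] at this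
  have h1 := hf'p s hsI
  rcases div_eq_zero_iff.1 this with h | h
  · exact h
  · linarith

theorem envelope_max (F : ℝ → ℝ → ℝ) (hF : Continuous (Function.uncurry F)) (τ0 δ p1 p2 : ℝ)
    (hδ : 0 < δ) (S : Set ℝ) (hSc : S.Countable)
    (hS : ∀ τ ∈ Icc (τ0 - δ) (τ0 + δ), ∀ p ∈ Ioo p1 p2, IsLocalMax (F τ) p → F τ p ∈ S)
    (ps : ℝ) (hps : ps ∈ Ioo p1 p2) (h1 : F τ0 p1 < F τ0 ps) (h2 : F τ0 p2 < F τ0 ps) :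
    ∃ p0 ∈ Ioo p1 p2, IsLocalMax (fun τ => F τ p0) τ0 := by
  have hcτ : ∀ p, Continuous (fun τ => F τ p) := fun p =>
    hF.comp (continuous_id.prodMk continuous_const)
  have hcp : ∀ τ, Continuous (F τ) := fun τ => hF.comp (continuous_const.prodMk continuous_id)
  have hev : ∀ᶠ τ in 𝓝 τ0, F τ p1 < F τ ps ∧ F τ p2 < F τ ps ∧ τ ∈ Icc (τ0 - δ) (τ0 + δ) := by
    have e1 := (hcτ p1).continuousAt.eventually_lt (hcτ ps).continuousAt h1
    have e2 := (hcτ p2).continuousAt.eventually_lt (hcτ ps).continuousAt h2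
    filter_upwards [e1, e2, Icc_mem_nhds (show τ0 - δ < τ0 by linarith)
      (show τ0 < τ0 + δ by linarith)] with τ a b c using ⟨a, b, c⟩
  obtain ⟨l, w, hlw, hsubs⟩ := mem_nhds_iff_exists_Ioo_subset.1 hev
  set M : ℝ → ℝ := fun τ => sSup (F τ '' Icc p1 p2) with hM
  have hMc : Continuous M := isCompact_Icc.continuous_sSup hF
  have hp12 : p1 ≤ p2 := by linarith [hps.1, hps.2]
  have hmax : ∀ τ ∈ Ioo l w, ∃ p ∈ Ioo p1 p2, (∀ x ∈ Icc p1 p2, F τ x ≤ F τ p) ∧ M τ = F τ p := by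
    intro τ hτ
    obtain ⟨p, hp, hpm⟩ := (isCompact_Icc (a := p1) (b := p2)).exists_isMaxOn
      (nonempty_Icc.2 hp12) (hcp τ).continuousOn
    have hpm' : ∀ x ∈ Icc p1 p2, F τ x ≤ F τ p := fun x hx => hpm hx
    obtain ⟨a1, a2, -⟩ := hsubs hτ
    have a3 := hpm' ps (Ioo_subset_Icc_self hps)
    refine ⟨p, ⟨lt_of_le_of_ne hp.1 ?_, lt_of_le_of_ne hp.2 ?_⟩, hpm', ?_⟩
    · rintro rfl; linarith
    · rintro rfl; linarith
    · have hg : IsGreatest (F τ '' Icc p1 p2) (F τ p) := by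
        refine ⟨⟨p, hp, rfl⟩, ?_⟩
        rintro _ ⟨x, hx, rfl⟩
        exact hpm' x hx
      exact hg.csSup_eq
  have hMS : ∀ τ ∈ Ioo l w, M τ ∈ S := by
    intro τ hτ
    obtain ⟨p, hp, hpm, hpe⟩ := hmax τ hτ
    rw [hpe]
    apply hS τ (hsubs hτ).2.2 p hp
    filter_upwards [Icc_mem_nhds hp.1 hp.2] with x hx using hpm x hx
  have hconst : ∀ τ ∈ Ioo l w, M τ = M τ0 := by
    intro τ hτ
    have hpre : IsPreconnected (M '' Ioo l w) := isPreconnected_Ioo.image M hMc.continuousOn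
    have hcnt : (M '' Ioo l w).Countable := hSc.mono (by rintro _ ⟨x, hx, rfl⟩; exact hMS x hx)
    have hnot : ∀ x ∈ M '' Ioo l w, ∀ y ∈ M '' Ioo l w, ¬ x < y := by
      intro x hx y hy hxy
      have := (hcnt.mono (hpre.Icc_subset hx hy)).measure_zero volume
      rw [Real.volume_Icc, ENNReal.ofReal_eq_zero] at this
      linarith
    exact le_antisymm (not_lt.1 (hnot _ ⟨τ0, hlw, rfl⟩ _ ⟨τ, hτ, rfl⟩))
      (not_lt.1 (hnot _ ⟨τ, hτ, rfl⟩ _ ⟨τ0, hlw, rfl⟩))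
  obtain ⟨p0, hp0, -, hp0e⟩ := hmax τ0 hlw
  refine ⟨p0, hp0, ?_⟩
  filter_upwards [Ioo_mem_nhds hlw.1 hlw.2] with τ hτ
  obtain ⟨p, hp, hpm, hpe⟩ := hmax τ hτ
  calc F τ p0 ≤ F τ p := hpm p0 (Ioo_subset_Icc_self hp0)
    _ = M τ := hpe.symm
    _ = M τ0 := hconst τ hτ
    _ = F τ0 p0 := hp0e

theorem exists_interior_gt (f : ℝ → ℝ) (p1 p2 d1 d2 : ℝ) (hp : p1 < p2)
    (h1 : HasDerivAt f d1 p1) (hd1 : 0 < d1) (h2 : HasDerivAt f d2 p2) (hd2 : d2 < 0) :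
    ∃ ps ∈ Ioo p1 p2, f p1 < f ps ∧ f p2 < f ps := by
  obtain ⟨x, hx, hfx⟩ : ∃ x ∈ Ioo p1 p2, f p1 < f x := by
    have := (hasDerivAt_iff_tendsto_slope.1 h1).eventually_const_lt hd1
    have h3 := this.filter_mono (nhdsWithin_mono p1 (show Ioi p1 ⊆ {p1}ᶜ from fun y hy => ne_of_gt hy))
    obtain ⟨x, hx, hx'⟩ := (h3.and (Ioo_mem_nhdsGT hp)).exists
    refine ⟨x, hx', ?_⟩
    rw [slope_def_field, lt_div_iff₀ (by linarith [hx'.1])] at hx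
    linarith
  obtain ⟨y, hy, hfy⟩ : ∃ x ∈ Ioo p1 p2, f p2 < f x := by
    have := (hasDerivAt_iff_tendsto_slope.1 h2).eventually_lt_const hd2
    have h3 := this.filter_mono (nhdsWithin_mono p2 (show Iio p2 ⊆ {p2}ᶜ from fun y hy => ne_of_lt hy))
    obtain ⟨x, hx, hx'⟩ := (h3.and (Ioo_mem_nhdsLT hp)).exists
    refine ⟨x, hx', ?_⟩
    rw [slope_def_field, div_lt_iff_of_neg (by linarith [hx'.2])] at hx
    linarith
  rcases le_total (f x) (f y) with h | h
  · exact ⟨y, hy, by linarith, hfy⟩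
  · exact ⟨x, hx, hfx, by linarith⟩

theorem alpha_nonconst (c : ℝ → ℝ) (R r1 r2 : ℝ) (h1 : R < r1) (h12 : r1 < r2) (h2 : r2 < 1)
    (hccc : {r | r ∈ Ioo R 1 ∧ deriv (alphaFun c) r = 0}.Countable) :
    ∃ x ∈ Ioo r1 r2, ∃ y ∈ Ioo r1 r2, x < y ∧ alphaFun c x ≠ alphaFun c y := by
  by_contra! hcon
  have hz : Ioo r1 r2 ⊆ {r | r ∈ Ioo R 1 ∧ deriv (alphaFun c) r = 0} := by
    intro r hr
    refine ⟨⟨by linarith [hr.1], by linarith [hr.2]⟩, ?_⟩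
    have : alphaFun c =ᶠ[𝓝 r] fun _ => alphaFun c r := by
      filter_upwards [Ioo_mem_nhds hr.1 hr.2] with y hy
      rcases lt_trichotomy r y with h | h | h
      · exact (hcon r hr y hy h).symm
      · rw [h]
      · exact hcon y hy r hr h
    rw [this.deriv_eq]; simp
  have := (hccc.mono hz).measure_zero volume
  rw [Real.volume_Ioo, ENNReal.ofReal_eq_zero] at this
  linarith

theorem sign_choice (x y : ℝ) (hx : 0 ≤ x) (hy : 0 ≤ y) (hxy : x ≠ y) :
    ∃ e : ℝ, e ≠ 0 ∧ ∃ n m : ℕ, 0 < n ∧ 0 < m ∧ Nat.Coprime n m ∧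
      0 < e * ((m : ℝ) / n * Real.pi - x) ∧ e * ((m : ℝ) / n * Real.pi - y) < 0 := by
  have hπ := Real.pi_pos
  have key : ∀ u v : ℝ, 0 ≤ u → u < v → ∃ n m : ℕ, 0 < n ∧ 0 < m ∧ Nat.Coprime n m ∧
      u < (m : ℝ) / n * Real.pi ∧ (m : ℝ) / n * Real.pi < v := by
    intro u v hu huv
    obtain ⟨q, hq1, hq2⟩ := exists_rat_btwn (show u / Real.pi < v / Real.pi by gcongr)
    have hq0 : 0 < q := by
      have : (0:ℝ) < q := lt_of_le_of_lt (by positivity) hq1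
      exact_mod_cast this
    have hnum : 0 < q.num := Rat.num_pos.2 hq0
    refine ⟨q.den, q.num.natAbs, q.den_pos, Int.natAbs_pos.2 hnum.ne', q.reduced.symm, ?_⟩
    have e : ((q.num.natAbs : ℕ) : ℝ) / (q.den : ℝ) = (q : ℝ) := by
      rw [Nat.cast_natAbs, abs_of_pos hnum]
      exact (Rat.cast_def q).symm
    rw [e]
    exact ⟨(div_lt_iff₀ hπ).1 hq1, (lt_div_iff₀ hπ).1 hq2⟩
  rcases lt_or_gt_of_ne hxy with h | h
  · obtain ⟨n, m, hn, hm, hc, h1, h2⟩ := key x y hx h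
    exact ⟨1, one_ne_zero, n, m, hn, hm, hc, by linarith, by linarith⟩
  · obtain ⟨n, m, hn, hm, hc, h1, h2⟩ := key y x hy h
    exact ⟨-1, by norm_num, n, m, hn, hm, hc, by linarith, by linarith⟩

theorem T_joint_cont (c : ℝ → ℝ → ℝ) (a t1 t2 : ℝ) (ha : 0 < a) (ha1 : a ≤ 1) (ht : t1 ≤ t2)
    (hpos : ∀ τ ∈ Icc t1 t2, ∀ s ∈ Icc a 1, 0 < c τ s)
    (hcont : ContinuousOn (fun p : ℝ × ℝ => c p.1 p.2) (Icc t1 t2 ×ˢ Icc a 1)) :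
    ∃ F : ℝ → ℝ → ℝ, Continuous (Function.uncurry F) ∧
      ∀ τ ∈ Icc t1 t2, ∀ p, F τ p = Tfun (c τ) a p := by
  set P : ℝ → ℝ := fun τ => (projIcc t1 t2 ht τ : ℝ) with hP
  set Q : ℝ → ℝ := fun s => (projIcc a 1 ha1 s : ℝ) with hQ
  have hPc : Continuous P := continuous_subtype_val.comp continuous_projIcc
  have hQc : Continuous Q := continuous_subtype_val.comp continuous_projIcc
  have hPm : ∀ τ, P τ ∈ Icc t1 t2 := fun τ => (projIcc t1 t2 ht τ).2
  have hQm : ∀ τ, Q τ ∈ Icc a 1 := fun τ => (projIcc a 1 ha1 τ).2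
  have hQ0 : ∀ s, Q s ≠ 0 := fun s => by linarith [(hQm s).1]
  refine ⟨fun τ p => ∫ s in a..1, √((Q s / c (P τ) (Q s)) ^ 2 - p ^ 2) * (Q s)⁻¹, ?_, ?_⟩
  · simp only [Function.uncurry_def]
    apply intervalIntegral.continuous_parametric_intervalIntegral_of_continuous'
      (f := fun (z : ℝ × ℝ) s => √((Q s / c (P z.1) (Q s)) ^ 2 - z.2 ^ 2) * (Q s)⁻¹)
    simp only [Function.uncurry_def]
    have h1 : Continuous (fun w : (ℝ × ℝ) × ℝ => c (P w.1.1) (Q w.2)) := by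
      have := hcont.comp_continuous (f := fun w : (ℝ × ℝ) × ℝ => (P w.1.1, Q w.2)) (by fun_prop)
        (fun w => ⟨hPm _, hQm _⟩)
      exact this
    have h2 : Continuous (fun w : (ℝ × ℝ) × ℝ => Q w.2) := by fun_prop
    have h3 := h2.div h1 (fun w => (hpos _ (hPm _) _ (hQm _)).ne')
    have h4 := h2.inv₀ (fun w => hQ0 _)
    exact ((h3.pow 2).sub (by fun_prop)).sqrt.mul h4
  · intro τ hτ p
    unfold Tfun
    apply intervalIntegral.integral_congr
    intro s hs
    rw [uIcc_of_le ha1] at hs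
    have e1 : P τ = τ := by simp only [hP]; rw [projIcc_of_mem ht hτ]
    have e2 : Q s = s := by simp only [hQ]; rw [projIcc_of_mem ha1 hs]
    simp only [e1, e2]

/-- The `τ`-derivative of `(s / c τ s)^2`. -/
noncomputable def hdot (c cdot : ℝ → ℝ → ℝ) (τ s : ℝ) : ℝ :=
  2 * (s / c τ s) * (- (s * cdot τ s) / (c τ s) ^ 2)

theorem T_tau_deriv (c cdot : ℝ → ℝ → ℝ) (R a r k τ0 δ : ℝ) (hR0 : 0 ≤ R) (ha : R < a)
    (hk : 0 < k) (hδ : 0 < δ)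
    (hpos : ∀ τ ∈ Icc (τ0 - δ) (τ0 + δ), ∀ r ∈ Icc R 1, 0 < c τ r)
    (hcont : ContinuousOn (fun p : ℝ × ℝ => c p.1 p.2) (Icc (τ0 - δ) (τ0 + δ) ×ˢ Icc R 1))
    (hd : ∀ τ ∈ Icc (τ0 - δ) (τ0 + δ), ∀ r ∈ Icc R 1, HasDerivAt (fun t => c t r) (cdot τ r) τ)
    (hdc : ContinuousOn (fun p : ℝ × ℝ => cdot p.1 p.2) (Icc (τ0 - δ) (τ0 + δ) ×ˢ Icc R 1))
    (hlow : ∀ x ∈ Icc R 1, ∀ y ∈ Icc R 1, x ≤ y → k * (y - x) ≤ y / c τ0 y - x / c τ0 x)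
    (hr : r ∈ Ioo a 1) :
    HasDerivAt (fun τ => Tfun (c τ) a (r / c τ0 r))
      (∫ s in r..1, hdot c cdot τ0 s * (2 * √((s / c τ0 s) ^ 2 - (r / c τ0 r) ^ 2))⁻¹ * s⁻¹) τ0 := by
  have hτ0 : τ0 ∈ Icc (τ0 - δ) (τ0 + δ) := ⟨by linarith, by linarith⟩
  have hrI : r ∈ Icc R 1 := ⟨by linarith [hr.1], hr.2.le⟩
  have hpp : 0 < r / c τ0 r := div_pos (by linarith [hr.1]) (hpos τ0 hτ0 r hrI)
  have hsub : Icc a 1 ⊆ Icc R 1 := Icc_subset_Icc_left ha.le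
  have hneg := sq_neg (c τ0) R a r k hR0 ha hk (hpos τ0 hτ0) hlow hr
  have hcτ : ∀ τ ∈ Icc (τ0 - δ) (τ0 + δ), ContinuousOn (c τ) (Icc R 1) := fun τ hτ =>
    hcont.comp (f := fun s => (τ, s)) (by fun_prop) (fun s hs => ⟨hτ, hs⟩)
  have hder : ∀ τ ∈ Icc (τ0 - δ) (τ0 + δ), ∀ s ∈ Icc R 1,
      HasDerivAt (fun t => (s / c t s) ^ 2 - (r / c τ0 r) ^ 2) (hdot c cdot τ s) τ := by
    intro τ hτ s hs
    have h1 := (((hasDerivAt_const τ s).div (hd τ hτ s hs) (hpos τ hτ s hs).ne').pow 2).sub_const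
      ((r / c τ0 r) ^ 2)
    refine h1.congr_deriv ?_
    simp [hdot]
  have hhc : ContinuousOn (fun p : ℝ × ℝ => hdot c cdot p.1 p.2)
      (Icc (τ0 - δ) (τ0 + δ) ×ˢ Icc R 1) := by
    have hsnd : ContinuousOn (fun p : ℝ × ℝ => p.2) (Icc (τ0 - δ) (τ0 + δ) ×ˢ Icc R 1) :=
      continuous_snd.continuousOn
    have hne : ∀ p ∈ Icc (τ0 - δ) (τ0 + δ) ×ˢ Icc R 1, c p.1 p.2 ≠ 0 := fun p hp =>
      (hpos _ hp.1 _ hp.2).ne'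
    exact (continuousOn_const.mul (hsnd.div hcont hne)).mul
      ((hsnd.mul hdc).neg.div (hcont.pow 2) fun p hp => pow_ne_zero 2 (hne p hp))
  obtain ⟨B, hB⟩ := (isCompact_Icc.prod isCompact_Icc).exists_bound_of_continuousOn hhc
  have hball : ∀ t ∈ Metric.ball τ0 δ, t ∈ Icc (τ0 - δ) (τ0 + δ) := by
    intro t ht
    rw [Real.ball_eq_Ioo] at ht
    exact Ioo_subset_Icc_self ht
  obtain ⟨-, hmain⟩ := hasDerivAt_sqrt_integral a r τ0 B (k * (r / c τ0 r)) δ (by linarith)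
    (by linarith [hr.1, hr.2]) (fun t s => (s / c t s) ^ 2 - (r / c τ0 r) ^ 2)
    (fun s => hdot c cdot τ0 s) (by positivity) hδ
    (fun t ht => ((continuousOn_id.div ((hcτ t (hball t ht)).mono hsub)
      (fun s hs => (hpos t (hball t ht) s (hsub hs)).ne')).pow 2).sub continuousOn_const)
    (by
      intro t ht s hs
      exact (convex_Icc (τ0 - δ) (τ0 + δ)).norm_image_sub_le_of_norm_hasDerivWithin_le
        (f := fun t => (s / c t s) ^ 2 - (r / c τ0 r) ^ 2) (f' := fun t => hdot c cdot t s)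
        (fun τ hτ => (hder τ hτ s (hsub hs)).hasDerivWithinAt)
        (fun τ hτ => hB (τ, s) ⟨hτ, hsub hs⟩) hτ0 (hball t ht))
    (fun s hs => hder τ0 hτ0 s (hsub hs))
    (hhc.comp (f := fun s => (τ0, s)) (by fun_prop) (fun s hs => ⟨hτ0, hsub hs⟩))
    (sq_lower (c τ0) R a r k hR0 ha hk (hpos τ0 hτ0) hlow hr)
  rw [integral_cut a r hr _ (fun s hs => by rw [hneg s hs]; simp)] at hmain
  exact hmain

theorem good_point (R : ℝ) (hR0 : 0 ≤ R) (hR1 : R < 1) (ε : ℝ)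
    (c : ℝ → ℝ → ℝ) (cdot : ℝ → ℝ → ℝ)
    (hpos : ∀ τ ∈ Ioo (-ε) ε, ∀ r ∈ Icc R 1, 0 < c τ r)
    (hlow : ∀ τ ∈ Ioo (-ε) ε, ∃ k, 0 < k ∧ ∀ x ∈ Icc R 1, ∀ y ∈ Icc R 1, x ≤ y →
      k * (y - x) ≤ y / c τ y - x / c τ x)
    (hccc : ∀ τ ∈ Ioo (-ε) ε, {r | r ∈ Ioo R 1 ∧ deriv (alphaFun (c τ)) r = 0}.Countable)
    (hcont : ContinuousOn (fun p : ℝ × ℝ => c p.1 p.2) (Ioo (-ε) ε ×ˢ Icc R 1))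
    (hd : ∀ τ ∈ Ioo (-ε) ε, ∀ r ∈ Icc R 1, HasDerivAt (fun t => c t r) (cdot τ r) τ)
    (hdc : ContinuousOn (fun p : ℝ × ℝ => cdot p.1 p.2) (Ioo (-ε) ε ×ˢ Icc R 1))
    (S : Set ℝ) (hSc : S.Countable) (hS : ∀ τ ∈ Ioo (-ε) ε, lsp (c τ) R = S)
    (τ0 : ℝ) (hτ0 : τ0 ∈ Ioo (-ε) ε) (r1 r2 : ℝ) (h1 : R < r1) (h12 : r1 < r2) (h2 : r2 < 1) :
    ∃ r ∈ Ioo r1 r2,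
      ∫ s in r..1, hdot c cdot τ0 s * (2 * √((s / c τ0 s) ^ 2 - (r / c τ0 r) ^ 2))⁻¹ * s⁻¹ = 0 := by
  obtain ⟨x, hx, y, hy, hxy, hne⟩ := alpha_nonconst (c τ0) R r1 r2 h1 h12 h2 (hccc τ0 hτ0)
  have hxR : x ∈ Ioo R 1 := ⟨by linarith [hx.1], by linarith [hx.2]⟩
  have hyR : y ∈ Ioo R 1 := ⟨by linarith [hy.1], by linarith [hy.2]⟩
  obtain ⟨e, he, n, m, hn, hm, hcop, hex, hey⟩ := sign_choice _ _
    (alpha_nonneg (c τ0) R x hR0 (hpos τ0 hτ0) hxR)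
    (alpha_nonneg (c τ0) R y hR0 (hpos τ0 hτ0) hyR) hne
  obtain ⟨k0, hk0, hlow0⟩ := hlow τ0 hτ0
  have hcτ : ∀ τ ∈ Ioo (-ε) ε, ContinuousOn (c τ) (Icc R 1) := fun τ hτ =>
    hcont.comp (f := fun s => (τ, s)) (by fun_prop) (fun s hs => ⟨hτ, hs⟩)
  set a := (R + x) / 2 with ha
  have haR : R < a := by rw [ha]; linarith [hxR.1]
  have hax : a < x := by rw [ha]; linarith [hxR.1]
  have haI : a ∈ Icc R 1 := ⟨haR.le, by linarith [hxR.2]⟩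
  have hxI := Ioo_subset_Icc_self hxR
  have hyI := Ioo_subset_Icc_self hyR
  have h1I : (1:ℝ) ∈ Icc R 1 := ⟨hR1.le, le_rfl⟩
  have hstrict : ∀ u ∈ Icc R 1, ∀ v ∈ Icc R 1, u < v → u / c τ0 u < v / c τ0 v := by
    intro u hu v hv huv
    have := hlow0 u hu v hv huv.le
    have : 0 < k0 * (v - u) := mul_pos hk0 (by linarith)
    linarith
  set p1 := x / c τ0 x with hp1
  set p2 := y / c τ0 y with hp2
  have hp12 : p1 < p2 := hstrict x hxI y hyI hxy
  have hρτ : ∀ s ∈ Icc R 1, ContinuousAt (fun τ => s / c τ s) τ0 := fun s hs =>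
    continuousAt_const.div (hd τ0 hτ0 s hs).continuousAt (hpos τ0 hτ0 s hs).ne'
  have hev : ∀ᶠ τ in 𝓝 τ0, a / c τ a < p1 ∧ p2 < 1 / c τ 1 ∧ τ ∈ Ioo (-ε) ε := by
    have e1 := (hρτ a haI).eventually_lt_const (hstrict a haI x hxI hax)
    have e2 := (hρτ 1 h1I).eventually_const_lt (hstrict y hyI 1 h1I hyR.2)
    filter_upwards [e1, e2, Ioo_mem_nhds hτ0.1 hτ0.2] with τ a b c using ⟨a, b, c⟩
  obtain ⟨δ, hδ, hball⟩ := Metric.nhds_basis_closedBall.mem_iff.1 hev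
  rw [Real.closedBall_eq_Icc] at hball
  have hsubε : Icc (τ0 - δ) (τ0 + δ) ⊆ Ioo (-ε) ε := fun τ hτ => (hball hτ).2.2
  have hτ0I : τ0 ∈ Icc (τ0 - δ) (τ0 + δ) := ⟨by linarith, by linarith⟩
  have hsubI : Icc a 1 ⊆ Icc R 1 := Icc_subset_Icc_left haR.le
  obtain ⟨T, hTc, hT⟩ := T_joint_cont c a (τ0 - δ) (τ0 + δ) (by linarith) haI.2 (by linarith)
    (fun τ hτ s hs => hpos τ (hsubε hτ) s (hsubI hs))
    (hcont.mono (prod_mono hsubε hsubI))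
  set w : ℝ := (m : ℝ) / n * Real.pi with hw
  set F : ℝ → ℝ → ℝ := fun τ p => e * (T τ p + w * p) with hF
  have hFc : Continuous (Function.uncurry F) := by
    have : Function.uncurry F = fun z => e * (Function.uncurry T z + w * z.2) := by
      ext z; rfl
    rw [this]; fun_prop
  have hFd : ∀ τ ∈ Icc (τ0 - δ) (τ0 + δ), ∀ r ∈ Ioo a 1,
      HasDerivAt (F τ) (e * (w - alphaFun (c τ) r)) (r / c τ r) ∧
      F τ (r / c τ r) = e * (Lfun (c τ) r - (r / c τ r) * alphaFun (c τ) r + w * (r / c τ r)) := by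
    intro τ hτ r hr
    obtain ⟨k, hk, hlk⟩ := hlow τ (hsubε hτ)
    obtain ⟨t1, t2⟩ := T_main (c τ) R a r k hR0 haR hk (hpos τ (hsubε hτ)) (hcτ τ (hsubε hτ)) hlk hr
    have hTe : T τ = Tfun (c τ) a := funext (hT τ hτ)
    constructor
    · have := (t1.add ((hasDerivAt_id (r / c τ r)).const_mul w)).const_mul e
      simp only [hF, hTe]
      refine this.congr_deriv ?_
      ring
    · simp only [hF, hTe, t2]; ring
  have hsurj : ∀ τ ∈ Icc (τ0 - δ) (τ0 + δ), ∀ p ∈ Icc p1 p2, ∃ r ∈ Ioo a 1, r / c τ r = p := by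
    intro τ hτ p hp
    have hc : ContinuousOn (fun r => r / c τ r) (Icc a 1) :=
      continuousOn_id.div ((hcτ τ (hsubε hτ)).mono hsubI)
        fun s hs => (hpos τ (hsubε hτ) s (hsubI hs)).ne'
    obtain ⟨b1, b2, -⟩ := hball hτ
    exact intermediate_value_Ioo haI.2 hc ⟨by linarith [hp.1], by linarith [hp.2]⟩
  have hxa : x ∈ Ioo a 1 := ⟨hax, hxR.2⟩
  have hya : y ∈ Ioo a 1 := ⟨by linarith, hyR.2⟩
  obtain ⟨ps, hps, hg1, hg2⟩ := exists_interior_gt (F τ0) p1 p2 _ _ hp12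
    (hFd τ0 hτ0I x hxa).1 hex (hFd τ0 hτ0I y hya).1 hey
  obtain ⟨p0, hp0, hmax⟩ := envelope_max F hFc τ0 δ p1 p2 hδ ((fun l => e * (l / (2 * n))) '' S)
    (hSc.image _) (by
      intro τ hτ p hp hloc
      obtain ⟨r, hr, rfl⟩ := hsurj τ hτ p (Ioo_subset_Icc_self hp)
      obtain ⟨f1, f2⟩ := hFd τ hτ r hr
      have hz := hloc.hasDerivAt_eq_zero f1
      have hα : alphaFun (c τ) r = w := by
        rcases mul_eq_zero.1 hz with h | h
        · exact absurd h he
        · linarith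
      have hn' : (n : ℝ) ≠ 0 := by positivity
      refine ⟨2 * (n : ℝ) * Lfun (c τ) r, ?_, ?_⟩
      · rw [← hS τ (hsubε hτ)]
        refine ⟨r, ⟨by linarith [hr.1], hr.2⟩, n, m, hn, hm, hcop, ?_, rfl⟩
        rw [hα, hw]; field_simp
      · rw [f2, hα]; field_simp; ring) ps hps hg1 hg2
  obtain ⟨r, hr, hrp⟩ := hsurj τ0 hτ0I p0 (Ioo_subset_Icc_self hp0)
  have hrI : r ∈ Icc R 1 := hsubI (Ioo_subset_Icc_self hr)
  have hrx : x < r := by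
    by_contra h
    have h' := not_lt.1 h
    rcases h'.lt_or_eq with h' | h'
    · have := hstrict r hrI x hxI h'; linarith [hp0.1]
    · rw [h'] at hrp; linarith [hp0.1]
  have hry : r < y := by
    by_contra h
    have h' := not_lt.1 h
    rcases h'.lt_or_eq with h' | h'
    · have := hstrict y hyI r hrI h'; linarith [hp0.2]
    · rw [← h'] at hrp; linarith [hp0.2]
  refine ⟨r, ⟨by linarith [hx.1], by linarith [hy.2]⟩, ?_⟩
  have hτd := T_tau_deriv c cdot R a r k0 τ0 δ hR0 haR hk0 hδ
    (fun τ hτ => hpos τ (hsubε hτ)) (hcont.mono (prod_mono hsubε Subset.rfl))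
    (fun τ hτ => hd τ (hsubε hτ)) (hdc.mono (prod_mono hsubε Subset.rfl)) hlow0 hr
  rw [hrp] at hτd ⊢
  have h3 := (hτd.add_const (w * p0)).const_mul e
  have hev2 : (fun τ => F τ p0) =ᶠ[𝓝 τ0] fun y => e * (Tfun (c y) a p0 + w * p0) := by
    filter_upwards [Icc_mem_nhds (show τ0 - δ < τ0 by linarith)
      (show τ0 < τ0 + δ by linarith)] with τ hτ
    simp only [hF, hT τ hτ]
  have hFτ := h3.congr_of_eventuallyEq hev2
  rcases mul_eq_zero.1 (hmax.hasDerivAt_eq_zero hFτ) with h | h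
  · exact absurd h he
  · exact h

theorem stmt11 (R : ℝ) (hR0 : 0 ≤ R) (hR1 : R < 1) (ε : ℝ) (hε : 0 < ε)
    (c : ℝ → ℝ → ℝ) (cdot : ℝ → ℝ → ℝ)
    (hpos : ∀ τ ∈ Set.Ioo (-ε) ε, ∀ r ∈ Set.Icc R 1, 0 < c τ r)
    (hC11 : ∀ τ ∈ Set.Ioo (-ε) ε, IsC11On (c τ) R)
    (hHerg : ∀ τ ∈ Set.Ioo (-ε) ε, HerglotzCond (c τ) R)
    (hccc : ∀ τ ∈ Set.Ioo (-ε) ε,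
      {r | r ∈ Set.Ioo R 1 ∧ deriv (alphaFun (c τ)) r = 0}.Countable)
    (hcont : ContinuousOn (fun p : ℝ × ℝ => c p.1 p.2) (Set.Ioo (-ε) ε ×ˢ Set.Icc R 1))
    (hdtau : ∀ τ ∈ Set.Ioo (-ε) ε, ∀ r ∈ Set.Icc R 1,
      HasDerivWithinAt (fun t => c t r) (cdot τ r) (Set.Ioo (-ε) ε) τ)
    (hdcont : ContinuousOn (fun p : ℝ × ℝ => cdot p.1 p.2)
      (Set.Ioo (-ε) ε ×ˢ Set.Icc R 1))
    (hR0' : R = 0 → ∀ τ ∈ Set.Ioo (-ε) ε, derivWithin (c τ) (Set.Icc R 1) 0 = 0)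
    (hlsp : ∀ τ ∈ Set.Ioo (-ε) ε, lsp (c τ) R = lsp (c 0) R) :
    ∀ τ ∈ Set.Ioo (-ε) ε, ∀ r ∈ Set.Icc R 1, c τ r = c 0 r := by
  have h0 : (0:ℝ) ∈ Ioo (-ε) ε := ⟨by linarith, hε⟩
  have hd : ∀ τ ∈ Ioo (-ε) ε, ∀ r ∈ Icc R 1, HasDerivAt (fun t => c t r) (cdot τ r) τ :=
    fun τ hτ r hr => (hdtau τ hτ r hr).hasDerivAt (Ioo_mem_nhds hτ.1 hτ.2)
  have hprops : ∀ τ ∈ Ioo (-ε) ε, _ := fun τ hτ =>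
    herglotz_props (c τ) R hR1 (hpos τ hτ) (hC11 τ hτ) (hHerg τ hτ)
  have hlow : ∀ τ ∈ Ioo (-ε) ε, ∃ k, 0 < k ∧ ∀ x ∈ Icc R 1, ∀ y ∈ Icc R 1, x ≤ y →
      k * (y - x) ≤ y / c τ y - x / c τ x := by
    intro τ hτ
    obtain ⟨ρ', g1, g2, g3⟩ := hprops τ hτ
    exact herglotz_lower _ ρ' R hR1 g1 g2 g3
  have hcτ : ∀ τ ∈ Ioo (-ε) ε, ContinuousOn (c τ) (Icc R 1) := fun τ hτ =>
    hcont.comp (f := fun s => (τ, s)) (by fun_prop) (fun s hs => ⟨hτ, hs⟩)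
  have hcdτ : ∀ τ ∈ Ioo (-ε) ε, ContinuousOn (cdot τ) (Icc R 1) := fun τ hτ =>
    hdcont.comp (f := fun s => (τ, s)) (by fun_prop) (fun s hs => ⟨hτ, hs⟩)
  have hzero : ∀ τ ∈ Ioo (-ε) ε, ∀ r ∈ Ioo R 1, cdot τ r = 0 := by
    intro τ hτ r hr
    obtain ⟨ρ', g1, g2, g3⟩ := hprops τ hτ
    set b := (R + r) / 2 with hb
    have hRb : R < b := by rw [hb]; linarith [hr.1]
    have hbr : b < r := by rw [hb]; linarith [hr.1]
    have hsub : Icc b 1 ⊆ Icc R 1 := Icc_subset_Icc_left hRb.le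
    have hp : ∀ s ∈ Icc b 1, 0 < s := fun s hs => by linarith [hs.1]
    have hcp : ∀ s ∈ Icc b 1, 0 < c τ s := fun s hs => hpos τ hτ s (hsub hs)
    have hρc : ContinuousOn (fun s => s / c τ s) (Icc b 1) :=
      continuousOn_id.div ((hcτ τ hτ).mono hsub) fun s hs => (hcp s hs).ne'
    have key := abel_apply b (by linarith [hr.2]) (fun s => (s / c τ s) ^ 2)
      (fun s => 2 * (s / c τ s) * ρ' s) (fun s => hdot c cdot τ s * 2⁻¹ * s⁻¹)
      (fun s hs => by
        have := ((g3 s (hsub hs)).mono hsub).pow 2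
        refine this.congr_deriv ?_
        simp)
      ((continuousOn_const.mul hρc).mul (g1.mono hsub))
      (fun s hs => by
        have h1 := hp s hs
        have h2 := hcp s hs
        have h3 := g2 s (hsub hs)
        positivity)
      (by
        have q1 : ContinuousOn (fun s => hdot c cdot τ s) (Icc b 1) := by
          unfold hdot
          exact (continuousOn_const.mul hρc).mul
            ((continuousOn_id.mul ((hcdτ τ hτ).mono hsub)).neg.div (((hcτ τ hτ).mono hsub).pow 2)
              fun s hs => pow_ne_zero 2 (hcp s hs).ne')
        exact (q1.mul continuousOn_const).mul (continuousOn_id.inv₀ fun s hs => (hp s hs).ne'))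
      (by
        intro r1 r2 k1 k2 k3
        obtain ⟨r', hr', hz⟩ := good_point R hR0 hR1 ε c cdot hpos hlow hccc hcont hd hdcont
          (lsp (c 0) R) (lsp_countable (c 0) R (hccc 0 h0)) hlsp τ hτ r1 r2 (by linarith) k2 k3
        refine ⟨r', hr', ?_⟩
        rw [← hz]
        congr 1; ext s
        rw [mul_inv]; ring) r ⟨hbr, hr.2⟩
    have hr0 : 0 < r := by linarith [hr.1]
    have hcr := hpos τ hτ r (Ioo_subset_Icc_self hr)
    simp only [hdot] at key
    have e : 2 * (r / c τ r) * (-(r * cdot τ r) / c τ r ^ 2) * 2⁻¹ * r⁻¹ =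
      cdot τ r * (- (r / c τ r ^ 3)) := by field_simp
    rw [e] at key
    rcases mul_eq_zero.1 key with h | h
    · exact h
    · have : 0 < r / c τ r ^ 3 := by positivity
      linarith
  have hzero' : ∀ τ ∈ Ioo (-ε) ε, ∀ r ∈ Icc R 1, cdot τ r = 0 := by
    intro τ hτ r hr
    have hcl : Icc R 1 ⊆ closure (Ioo R 1) := by rw [closure_Ioo hR1.ne]
    have : EqOn (cdot τ) (fun _ => 0) (Icc R 1) :=
      EqOn.of_subset_closure (hzero τ hτ) (hcdτ τ hτ) continuousOn_const Ioo_subset_Icc_self hcl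
    exact this hr
  intro τ hτ r hr
  refine (convex_Ioo (-ε) ε).is_const_of_fderivWithin_eq_zero (𝕜 := ℝ) (f := fun t => c t r)
    (fun t ht => (hdtau t ht r hr).differentiableWithinAt) ?_ hτ h0
  intro t ht
  have h1 := hdtau t ht r hr
  rw [hzero' t ht r hr] at h1
  rw [h1.hasFDerivWithinAt.fderivWithin (isOpen_Ioo.uniqueDiffWithinAt ht)]
  ext; simp
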